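/- Assume that all functions in N^{1,p}(X) are quasicontinuous. Assume further that A ⊂ int E if p > 1, or dist(A, X \ E) > 0 if p = 1. Then cap_p(A,E) = inf_u ∫_X g_u^p dμ, where the infimum is taken over all functions u ∈ N^{1,p}_0(E) such that u ≥ 1 in some open set containing A. -/

import Mathlib

open MeasureTheory Metric Set Filter
open scoped ENNReal NNReal Topology

noncomputable section

variable {X : Type*} [MetricSpace X] [MeasurableSpace X] [BorelSpace X]

/-- A nonconstant, compact, rectifiable curve in `X`, parameterized by arc length on
`[0, len]`. The arc-length parameterization is expressed by requiring that the length
(total variation) of the curve on each subinterval `[s, t]` equals `t - s`. -/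
structure Curve (X : Type*) [MetricSpace X] where
  len : ℝ
  len_pos : 0 < len
  toFun : ℝ → X
  continuousOn : ContinuousOn toFun (Set.Icc 0 len)
  arclength : ∀ s t : ℝ, s ∈ Set.Icc 0 len → t ∈ Set.Icc 0 len → s ≤ t →
    eVariationOn toFun (Set.Icc s t) = ENNReal.ofReal (t - s)
  nonconstant : ∃ s ∈ Set.Icc 0 len, ∃ t ∈ Set.Icc 0 len, toFun s ≠ toFun t

/-- The curve integral `∫_γ g ds` of a nonnegative function along an arc-length
parameterized curve. -/
def Curve.integral (γ : Curve X) (g : X → ℝ≥0∞) : ℝ≥0∞ :=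
  ∫⁻ t in Set.Icc (0 : ℝ) γ.len, g (γ.toFun t)

/-- `|a - b|` with the convention that it is `∞` whenever both `a` and `b` are infinite. -/
def ugDiff (a b : EReal) : ℝ≥0∞ :=
  if a.abs = ⊤ ∨ b.abs = ⊤ then ⊤ else (a - b).abs

/-- The upper gradient inequality for `f` and `g` along the curve `γ`. -/
def UGOn (f : X → EReal) (g : X → ℝ≥0∞) (γ : Curve X) : Prop :=
  ugDiff (f (γ.toFun 0)) (f (γ.toFun γ.len)) ≤ γ.integral g

/-- A curve family has zero `p`-modulus. -/
def ZeroModulus (p : ℝ) (μ : Measure X) (Γ : Set (Curve X)) : Prop :=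
  ∃ ρ : X → ℝ≥0∞, Measurable ρ ∧ (∫⁻ x, ρ x ^ p ∂μ) < ⊤ ∧ ∀ γ ∈ Γ, γ.integral ρ = ⊤

/-- `g` is an upper gradient of `f`. -/
def IsUpperGradient (f : X → EReal) (g : X → ℝ≥0∞) : Prop :=
  Measurable g ∧ ∀ γ : Curve X, UGOn f g γ

/-- `g` is a `p`-weak upper gradient of `f`: the upper gradient inequality holds for
`p`-almost every curve. -/
def IsWeakUpperGradient (p : ℝ) (μ : Measure X) (f : X → EReal) (g : X → ℝ≥0∞) : Prop :=
  Measurable g ∧ ZeroModulus p μ {γ : Curve X | ¬ UGOn f g γ}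

/-- The energy `∫_X g_u^p dμ` of the minimal `p`-weak upper gradient of `u`, expressed as
the infimum of `∫_X g^p dμ` over all `p`-weak upper gradients `g` of `u`
(`= ∞` if `u` has no `p`-weak upper gradient). -/
def gradEnergy (p : ℝ) (μ : Measure X) (u : X → EReal) : ℝ≥0∞ :=
  ⨅ (g : X → ℝ≥0∞) (_ : IsWeakUpperGradient p μ u g), ∫⁻ x, g x ^ p ∂μ

/-- The Newtonian energy `‖u‖_{N^{1,p}(X)}^p = ∫_X |u|^p dμ + ∫_X g_u^p dμ`. -/
def newtonianEnergy (p : ℝ) (μ : Measure X) (u : X → EReal) : ℝ≥0∞ :=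
  (∫⁻ x, (u x).abs ^ p ∂μ) + gradEnergy p μ u

/-- Membership in the Newtonian space `N^{1,p}(X)` (measurability is with respect to the
completion of the Borel σ-algebra, i.e. a.e.-measurability). -/
def MemNewtonian (p : ℝ) (μ : Measure X) (u : X → EReal) : Prop :=
  AEMeasurable u μ ∧ newtonianEnergy p μ u < ⊤

/-- Membership in `N^{1,p}_0(E)`, members being regarded as functions on all of `X`
that vanish outside `E`. -/
def MemNewtonian0 (p : ℝ) (μ : Measure X) (E : Set X) (u : X → EReal) : Prop :=
  MemNewtonian p μ u ∧ ∀ x ∉ E, u x = 0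

/-- The Sobolev capacity `C_p(A)`. -/
def sobolevCapacity (p : ℝ) (μ : Measure X) (A : Set X) : ℝ≥0∞ :=
  ⨅ (u : X → EReal) (_ : MemNewtonian p μ u ∧ ∀ x ∈ A, u x = 1), newtonianEnergy p μ u

/-- The variational capacity `cap_p(A, E)`. -/
def varCapacity (p : ℝ) (μ : Measure X) (A E : Set X) : ℝ≥0∞ :=
  ⨅ (u : X → EReal) (_ : MemNewtonian0 p μ E u ∧ ∀ x ∈ A, 1 ≤ u x), gradEnergy p μ u

/-- A function is quasicontinuous if outside open sets of arbitrarily small Sobolev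
capacity it is real-valued and continuous. -/
def QuasicontinuousFun (p : ℝ) (μ : Measure X) (u : X → EReal) : Prop :=
  ∀ ε : ℝ≥0∞, 0 < ε → ∃ G : Set X, IsOpen G ∧ sobolevCapacity p μ G < ε ∧
    (∀ x ∈ Gᶜ, u x ≠ ⊤ ∧ u x ≠ ⊥) ∧ ContinuousOn u Gᶜ

/-- The capacity `~cap_p(A,E)`: the infimum of `cap_p(G,E)` over all relatively open
subsets `G` of `E` containing `A`. -/
def varCapacityT (p : ℝ) (μ : Measure X) (A E : Set X) : ℝ≥0∞ :=
  ⨅ (G : Set X) (_ : A ⊆ G ∧ G ⊆ E ∧ ∃ U : Set X, IsOpen U ∧ G = U ∩ E),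
    varCapacity p μ G E

set_option linter.unusedSectionVars false

section Clamp

/-- The truncation of an extended real number to the interval `[a, b]`. -/
def clampReal (a b : ℝ) (x : EReal) : ℝ := (max (a : EReal) (min x b)).toReal

lemma clampReal_coe (a b r : ℝ) : clampReal a b r = max a (min r b) := by
  unfold clampReal
  rw [← EReal.coe_strictMono.monotone.map_min, ← EReal.coe_strictMono.monotone.map_max,
    EReal.toReal_coe]

lemma clampReal_top (a b : ℝ) : clampReal a b ⊤ = max a b := by
  unfold clampReal
  rw [min_eq_right le_top, ← EReal.coe_strictMono.monotone.map_max, EReal.toReal_coe]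

lemma clampReal_bot (a b : ℝ) : clampReal a b ⊥ = a := by
  simp [clampReal]

lemma le_clampReal (a b : ℝ) (x : EReal) : a ≤ clampReal a b x := by
  induction x with
  | bot => simp [clampReal_bot]
  | top => simp [clampReal_top]
  | coe r => simp [clampReal_coe]

lemma clampReal_le {a b : ℝ} (hab : a ≤ b) (x : EReal) : clampReal a b x ≤ b := by
  induction x with
  | bot => simp [clampReal_bot, hab]
  | top => simp [clampReal_top, hab]
  | coe r => simp [clampReal_coe, hab]

lemma clampReal_eq_of_le {a b : ℝ} (hab : a ≤ b) {x : EReal} (hx : (b : EReal) ≤ x) :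
    clampReal a b x = b := by
  unfold clampReal
  rw [min_eq_right hx, max_eq_right (by exact_mod_cast hab), EReal.toReal_coe]

lemma lt_of_lt_clampReal {a b : ℝ} {x : EReal} (h : a < clampReal a b x) : (a : EReal) < x := by
  by_contra! hx
  unfold clampReal at h
  rw [max_eq_left ((min_le_left _ _).trans hx), EReal.toReal_coe] at h
  exact lt_irrefl _ h

lemma measurable_clampReal (a b : ℝ) : Measurable (clampReal a b) :=
  (measurable_const.max (measurable_id.min measurable_const)).ereal_toReal

lemma EReal.exists_coe_of_abs_ne_top {x : EReal} (h : x.abs ≠ ⊤) : ∃ r : ℝ, x = r := by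
  induction x with
  | bot => simp at h
  | top => simp at h
  | coe r => exact ⟨r, rfl⟩

lemma EReal.measurable_abs : Measurable EReal.abs :=
  EReal.measurable_of_measurable_real (ENNReal.measurable_ofReal.comp measurable_norm)

lemma ugDiff_coe (a b : ℝ) : ugDiff (a : EReal) (b : EReal) = edist a b := by
  unfold ugDiff
  rw [if_neg (by simp [EReal.abs_def]), ← EReal.coe_sub, EReal.abs_def, edist_dist, Real.dist_eq]

lemma edist_clampReal_le (a b : ℝ) (x y : EReal) :
    edist (clampReal a b x) (clampReal a b y) ≤ ugDiff x y := by
  by_cases h : x.abs = ⊤ ∨ y.abs = ⊤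
  · simp [ugDiff, h]
  · push Not at h
    obtain ⟨r, rfl⟩ := EReal.exists_coe_of_abs_ne_top h.1
    obtain ⟨s, rfl⟩ := EReal.exists_coe_of_abs_ne_top h.2
    rw [ugDiff_coe, clampReal_coe, clampReal_coe, edist_dist, edist_dist, Real.dist_eq,
      Real.dist_eq]
    refine ENNReal.ofReal_le_ofReal ?_
    refine (abs_max_sub_max_le_max _ _ _ _).trans ?_
    rw [sub_self, abs_zero]
    refine max_le (abs_nonneg _) ((abs_min_sub_min_le_max _ _ _ _).trans ?_)
    simp

end Clamp

section Curves

lemma Curve.integral_mono (γ : Curve X) {g h : X → ℝ≥0∞} (hgh : ∀ x, g x ≤ h x) :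
    γ.integral g ≤ γ.integral h :=
  lintegral_mono fun _ => hgh _

lemma Curve.integral_const_mul (γ : Curve X) {c : ℝ≥0∞} (hc : c ≠ ⊤) (g : X → ℝ≥0∞) :
    γ.integral (fun x => c * g x) = c * γ.integral g :=
  lintegral_const_mul' _ _ hc

/-- The restriction of a curve to a nondegenerate subinterval. -/
def Curve.sub (γ : Curve X) (s t : ℝ) (hs : 0 ≤ s) (hst : s < t) (ht : t ≤ γ.len) : Curve X where
  len := t - s
  len_pos := sub_pos.2 hst
  toFun := fun r => γ.toFun (s + r)
  continuousOn := γ.continuousOn.comp (by fun_prop) fun r hr =>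
    ⟨by linarith [hr.1], by linarith [hr.2]⟩
  arclength := fun a b ha hb hab => by
    have h := eVariationOn.comp_eq_of_monotoneOn γ.toFun (t := Icc a b) (fun r => s + r)
      (fun x _ y _ h => by simpa using h)
    rw [image_const_add_Icc] at h
    refine h.trans ?_
    rw [γ.arclength _ _ ⟨by linarith [ha.1], by linarith [ha.2]⟩
      ⟨by linarith [hb.1], by linarith [hb.2]⟩ (by linarith)]
    congr 1
    ring
  nonconstant := by
    by_contra! hcon
    have h0 : eVariationOn γ.toFun (Icc s t) = 0 := by
      rw [eVariationOn.eq_zero_iff]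
      intro x hx y hy
      have := hcon (x - s) ⟨by linarith [hx.1], by linarith [hx.2]⟩ (y - s)
        ⟨by linarith [hy.1], by linarith [hy.2]⟩
      simp only [add_sub_cancel] at this
      rw [this, edist_self]
    rw [γ.arclength s t ⟨hs, by linarith⟩ ⟨by linarith, ht⟩ hst.le, ENNReal.ofReal_eq_zero] at h0
    linarith

lemma Curve.integral_sub_le (γ : Curve X) (s t : ℝ) (hs : 0 ≤ s) (hst : s < t) (ht : t ≤ γ.len)
    (g : X → ℝ≥0∞) : (γ.sub s t hs hst ht).integral g ≤ γ.integral g := by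
  unfold Curve.integral
  rw [← lintegral_indicator measurableSet_Icc, ← lintegral_indicator measurableSet_Icc,
    ← lintegral_add_left_eq_self (fun r => (Icc 0 γ.len).indicator (fun r => g (γ.toFun r)) r) s]
  refine lintegral_mono fun r => ?_
  by_cases hr : r ∈ Icc 0 (t - s)
  · have hr' : s + r ∈ Icc 0 γ.len := ⟨by linarith [hr.1], by linarith [hr.2]⟩
    rw [indicator_of_mem (by exact hr), indicator_of_mem hr']
    rfl
  · rw [indicator_of_notMem (by exact hr)]
    exact zero_le

lemma Curve.edist_endpoints_le (γ : Curve X) :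
    edist (γ.toFun 0) (γ.toFun γ.len) ≤ ENNReal.ofReal γ.len := by
  have h0 : (0 : ℝ) ∈ Icc 0 γ.len := ⟨le_rfl, γ.len_pos.le⟩
  have h1 : γ.len ∈ Icc 0 γ.len := ⟨γ.len_pos.le, le_rfl⟩
  have h := γ.arclength 0 γ.len h0 h1 γ.len_pos.le
  rw [sub_zero] at h
  exact h ▸ eVariationOn.edist_le _ h0 h1

end Curves

section Modulus

variable {p : ℝ} {μ : Measure X}

lemma ZeroModulus.mono {Γ Γ' : Set (Curve X)} (h : ZeroModulus p μ Γ') (hs : Γ ⊆ Γ') :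
    ZeroModulus p μ Γ := by
  obtain ⟨ρ, h1, h2, h3⟩ := h
  exact ⟨ρ, h1, h2, fun γ hγ => h3 γ (hs hγ)⟩

lemma ZeroModulus.exists_lintegral_le (hp : 1 ≤ p) {Γ : Set (Curve X)} (h : ZeroModulus p μ Γ)
    {ε : ℝ≥0∞} (hε : 0 < ε) :
    ∃ ρ : X → ℝ≥0∞, Measurable ρ ∧ (∫⁻ x, ρ x ^ p ∂μ) ≤ ε ∧ ∀ γ ∈ Γ, γ.integral ρ = ⊤ := by
  obtain ⟨ρ, h1, h2, h3⟩ := h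
  set I := ∫⁻ x, ρ x ^ p ∂μ with hI
  set c : ℝ≥0∞ := min 1 (ε / (I + 1)) with hc
  have hc0 : c ≠ 0 := by
    have : 0 < ε / (I + 1) := ENNReal.div_pos hε.ne' (by simp [h2.ne])
    exact (lt_min one_pos this).ne'
  have hc1 : c ≤ 1 := min_le_left _ _
  have hct : c ≠ ⊤ := ne_top_of_le_ne_top ENNReal.one_ne_top hc1
  refine ⟨fun x => c * ρ x, h1.const_mul c, ?_, fun γ hγ => ?_⟩
  · simp_rw [ENNReal.mul_rpow_of_nonneg _ _ (zero_le_one.trans hp)]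
    rw [lintegral_const_mul' _ _ (ENNReal.rpow_ne_top_of_nonneg (zero_le_one.trans hp) hct), ← hI]
    calc c ^ p * I ≤ c * (I + 1) := by
          gcongr
          · exact ENNReal.rpow_le_self_of_le_one hc1 hp
          · exact le_self_add
      _ ≤ ε / (I + 1) * (I + 1) := by gcongr; exact min_le_right _ _
      _ ≤ ε := by rw [mul_comm]; exact ENNReal.mul_div_le
  · rw [γ.integral_const_mul hct, h3 γ hγ, ENNReal.mul_top hc0]

lemma iSup_rpow_le_tsum (hp : 1 ≤ p) {ι : Type*} (a : ι → ℝ≥0∞) :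
    (⨆ i, a i) ^ p ≤ ∑' i, a i ^ p := by
  have hp0 : 0 < p := zero_lt_one.trans_le hp
  rw [← ENNReal.le_rpow_inv_iff hp0]
  refine iSup_le fun i => ?_
  rw [ENNReal.le_rpow_inv_iff hp0]
  exact ENNReal.le_tsum i

lemma lintegral_iSup_rpow_le (hp : 1 ≤ p) {ι : Type*} [Countable ι] {g : ι → X → ℝ≥0∞}
    (hg : ∀ i, Measurable (g i)) :
    ∫⁻ x, (⨆ i, g i x) ^ p ∂μ ≤ ∑' i, ∫⁻ x, g i x ^ p ∂μ := by
  rw [← lintegral_tsum fun i => ((hg i).pow_const p).aemeasurable]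
  exact lintegral_mono fun x => iSup_rpow_le_tsum hp _

lemma zeroModulus_iUnion (hp : 1 ≤ p) {ι : Type*} [Countable ι] {Γ : ι → Set (Curve X)}
    (h : ∀ i, ZeroModulus p μ (Γ i)) : ZeroModulus p μ (⋃ i, Γ i) := by
  obtain ⟨ε, hε, hsum⟩ := ENNReal.exists_pos_sum_of_countable' one_ne_zero ι
  choose ρ h1 h2 h3 using fun i => (h i).exists_lintegral_le hp (hε i)
  refine ⟨fun x => ⨆ i, ρ i x, .iSup h1, ?_, fun γ hγ => ?_⟩
  · exact (lintegral_iSup_rpow_le hp h1).trans_lt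
      ((ENNReal.tsum_le_tsum h2).trans_lt (hsum.trans ENNReal.one_lt_top))
  · obtain ⟨i, hi⟩ := mem_iUnion.1 hγ
    exact top_le_iff.1 ((h3 i γ hi).ge.trans
      (γ.integral_mono fun x => le_iSup (fun i => ρ i x) i))

end Modulus

section WeakUpperGradients

variable {p : ℝ} {μ : Measure X}

lemma ugOn_coe_iff {f : X → ℝ} {g : X → ℝ≥0∞} {γ : Curve X} :
    UGOn (fun x => (f x : EReal)) g γ ↔
      edist (f (γ.toFun 0)) (f (γ.toFun γ.len)) ≤ γ.integral g := by
  rw [UGOn, ugDiff_coe]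

/-- Affine functions of truncations. -/
lemma IsWeakUpperGradient.clampReal {u : X → EReal} {g : X → ℝ≥0∞}
    (h : IsWeakUpperGradient p μ u g) (a b d : ℝ) (c : ℝ≥0) :
    IsWeakUpperGradient p μ (fun x => ((c * clampReal a b (u x) + d : ℝ) : EReal))
      (fun x => c * g x) := by
  refine ⟨h.1.const_mul _, h.2.mono fun γ hγ hu => hγ ?_⟩
  rw [ugOn_coe_iff, γ.integral_const_mul ENNReal.coe_ne_top]
  rw [edist_add_right, ← smul_eq_mul, ← smul_eq_mul, edist_smul₀, ENNReal.smul_def, smul_eq_mul,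
    show ‖(c : ℝ)‖₊ = c from Real.nnnorm_of_nonneg c.2]
  gcongr
  exact (edist_clampReal_le _ _ _ _).trans hu

/-- Suprema of countable families. -/
lemma IsWeakUpperGradient.iSup (hp : 1 ≤ p) {ι : Type*} [Countable ι] [Nonempty ι]
    {f : ι → X → ℝ} {g : ι → X → ℝ≥0∞} (hf : ∀ x, BddAbove (range fun i => f i x))
    (h : ∀ i, IsWeakUpperGradient p μ (fun x => (f i x : EReal)) (g i)) :
    IsWeakUpperGradient p μ (fun x => ((⨆ i, f i x : ℝ) : EReal)) (fun x => ⨆ i, g i x) := by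
  refine ⟨.iSup fun i => (h i).1, (zeroModulus_iUnion hp fun i => (h i).2).mono fun γ hγ => ?_⟩
  by_contra hcon
  simp only [mem_iUnion, not_exists, mem_ofPred_eq, not_not] at hcon
  refine hγ ?_
  rw [ugOn_coe_iff]
  by_cases htop : γ.integral (fun x => ⨆ i, g i x) = ⊤
  · rw [htop]; exact le_top
  have key : ∀ i, dist (f i (γ.toFun 0)) (f i (γ.toFun γ.len)) ≤
      (γ.integral fun x => ⨆ i, g i x).toReal := fun i => by
    have h1 := (ugOn_coe_iff.1 (hcon i)).trans
      (γ.integral_mono fun x => le_iSup (fun i => g i x) i)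
    rw [edist_dist] at h1
    exact (ENNReal.ofReal_le_iff_le_toReal htop).1 h1
  rw [edist_dist]
  refine ENNReal.ofReal_le_of_le_toReal ?_
  rw [Real.dist_eq, abs_sub_le_iff, sub_le_iff_le_add, sub_le_iff_le_add]
  constructor
  · refine ciSup_le fun i => ?_
    have h1 := (abs_sub_le_iff.1 (Real.dist_eq _ _ ▸ key i)).1
    have h2 := le_ciSup (hf (γ.toFun γ.len)) i
    linarith
  · refine ciSup_le fun i => ?_
    have h1 := (abs_sub_le_iff.1 (Real.dist_eq _ _ ▸ key i)).2
    have h2 := le_ciSup (hf (γ.toFun 0)) i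
    linarith

/-- Cutting off a nonnegative function `h` by a Lipschitz function: the Lipschitz constant only
contributes to the gradient where `h` is positive. -/
lemma IsWeakUpperGradient.min_lipschitz {h η : X → ℝ} {g : X → ℝ≥0∞} {L : ℝ≥0} {S : Set X}
    (hg : IsWeakUpperGradient p μ (fun x => (h x : EReal)) g) (h0 : ∀ x, 0 ≤ h x)
    (hη : LipschitzWith L η) (η0 : ∀ x, 0 ≤ η x) (hS : MeasurableSet S)
    (hSh : ∀ x, 0 < h x → x ∈ S) :
    IsWeakUpperGradient p μ (fun x => ((min (h x) (η x) : ℝ) : EReal))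
      (fun x => max (g x) (S.indicator (fun _ => (L : ℝ≥0∞)) x)) := by
  obtain ⟨gm, ρ, ρm, ρI, hρ⟩ := hg
  refine ⟨gm.max (measurable_const.indicator hS), ρ, ρm, ρI, fun γ hγ => ?_⟩
  by_contra hfin
  have sub_ok : ∀ s t : ℝ, 0 ≤ s → s < t → t ≤ γ.len →
      edist (h (γ.toFun s)) (h (γ.toFun t)) ≤ γ.integral g := by
    intro s t hs hst ht
    have h1 : UGOn (fun x => (h x : EReal)) g (γ.sub s t hs hst ht) := by
      by_contra hbad
      exact hfin (top_le_iff.1 ((hρ _ hbad).ge.trans (γ.integral_sub_le s t hs hst ht ρ)))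
    rw [ugOn_coe_iff] at h1
    refine le_trans (le_of_eq ?_) (h1.trans (γ.integral_sub_le s t hs hst ht g))
    simp [Curve.sub]
  have from_zero : ∀ s t : ℝ, 0 ≤ s → s < t → t ≤ γ.len →
      h (γ.toFun s) = 0 ∨ h (γ.toFun t) = 0 →
      ENNReal.ofReal (max (h (γ.toFun s)) (h (γ.toFun t))) ≤ γ.integral g := by
    intro s t hs hst ht h1
    refine le_trans (le_of_eq ?_) (sub_ok s t hs hst ht)
    rw [edist_dist, Real.dist_eq]
    rcases h1 with h1 | h1 <;> simp [h1, h0, abs_of_nonneg]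
  have le_max_int : γ.integral g ≤
      γ.integral fun x => max (g x) (S.indicator (fun _ => (L : ℝ≥0∞)) x) :=
    γ.integral_mono fun x => le_max_left _ _
  refine hγ ?_
  rw [ugOn_coe_iff]
  set x := γ.toFun 0 with hx
  set y := γ.toFun γ.len with hy
  by_cases hpos : ∀ t ∈ Icc 0 γ.len, 0 < h (γ.toFun t)
  · have hlip : edist (η x) (η y) ≤
        γ.integral fun x => max (g x) (S.indicator (fun _ => (L : ℝ≥0∞)) x) := by
      calc edist (η x) (η y) ≤ L * edist x y := hη x y
        _ ≤ L * ENNReal.ofReal γ.len := by gcongr; exact γ.edist_endpoints_le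
        _ = ∫⁻ t in Icc 0 γ.len, L := by simp
        _ ≤ _ := setLIntegral_mono' measurableSet_Icc fun t ht => by
          refine le_trans (le_of_eq ?_) (le_max_right _ _)
          rw [indicator_of_mem (hSh _ (hpos t ht))]
    have h1 := (sub_ok 0 γ.len le_rfl γ.len_pos le_rfl).trans le_max_int
    refine le_trans ?_ (max_le h1 hlip)
    simp only [edist_dist, Real.dist_eq, ← ENNReal.ofReal_max]
    exact ENNReal.ofReal_le_ofReal (abs_min_sub_min_le_max _ _ _ _)
  · push Not at hpos
    obtain ⟨t, ht, htn⟩ := hpos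
    have ht0 : h (γ.toFun t) = 0 := le_antisymm htn (h0 _)
    refine le_trans ?_ le_max_int
    have hbound : edist (min (h x) (η x)) (min (h y) (η y)) ≤
        ENNReal.ofReal (max (h x) (h y)) := by
      rw [edist_dist, Real.dist_eq]
      refine ENNReal.ofReal_le_ofReal ?_
      have a1 : 0 ≤ min (h x) (η x) := le_min (h0 _) (η0 _)
      have a2 : 0 ≤ min (h y) (η y) := le_min (h0 _) (η0 _)
      have a3 := min_le_left (h x) (η x)
      have a4 := min_le_left (h y) (η y)
      have a5 := le_max_left (h x) (h y)
      have a6 := le_max_right (h x) (h y)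
      rw [abs_sub_le_iff]
      constructor <;> linarith
    refine hbound.trans ?_
    rw [ENNReal.ofReal_max]
    refine max_le ?_ ?_
    · rcases ht.1.eq_or_lt with h1 | h1
      · rw [hx, h1, ht0]; simp
      · refine le_trans (ENNReal.ofReal_le_ofReal (le_max_left _ _))
          (from_zero 0 t le_rfl h1 ht.2 (Or.inr ht0))
    · rcases ht.2.eq_or_lt with h1 | h1
      · rw [hy, ← h1, ht0]; simp
      · refine le_trans (ENNReal.ofReal_le_ofReal (le_max_right _ _))
          (from_zero t γ.len ht.1 h1 le_rfl (Or.inl ht0))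

end WeakUpperGradients

section Capacity

variable {p : ℝ} {μ : Measure X}

/-- A set of small Sobolev capacity has a localized test function of small energy. -/
lemma exists_cutoff_of_sobolevCapacity_lt (hp : 1 ≤ p) {V : Set X} {δ : ℝ≥0∞}
    (hV : sobolevCapacity p μ V < δ) {η : X → ℝ} {L : ℝ≥0} (hη : LipschitzWith L η)
    (η0 : ∀ x, 0 ≤ η x) :
    ∃ (f : X → ℝ) (g : X → ℝ≥0∞), AEMeasurable f μ ∧
      IsWeakUpperGradient p μ (fun x => (f x : EReal)) g ∧
      (∀ x, 0 ≤ f x) ∧ (∀ x, f x ≤ 1) ∧ (∀ x, f x ≤ η x) ∧ (∀ x ∈ V, min 1 (η x) ≤ f x) ∧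
      ∫⁻ x, g x ^ p ∂μ ≤ 2 ^ p * (1 + (L : ℝ≥0∞) ^ p) * δ := by
  have hp0 : 0 ≤ p := zero_le_one.trans hp
  obtain ⟨w, ⟨⟨wm, -⟩, w1⟩, hw⟩ := by simpa only [sobolevCapacity, iInf_lt_iff] using hV
  have hwp : ∫⁻ x, (w x).abs ^ p ∂μ ≤ δ := le_self_add.trans hw.le
  have hwg : gradEnergy p μ w < δ := lt_of_le_of_lt le_add_self hw
  obtain ⟨g, hg, hgδ⟩ := by simpa only [gradEnergy, iInf_lt_iff] using hwg
  set S := toMeasurable μ {x | (2⁻¹ : ℝ≥0∞) ≤ (w x).abs} with hS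
  have hSm : MeasurableSet S := measurableSet_toMeasurable _ _
  have hhalf : ((2⁻¹ : ℝ)) ≤ 1 := by norm_num
  let h : X → ℝ := fun x => (2 : ℝ≥0) * clampReal 2⁻¹ 1 (w x) + (-1)
  have hh0 : ∀ x, 0 ≤ h x := fun x => by
    have := le_clampReal 2⁻¹ 1 (w x)
    simp only [h, NNReal.coe_ofNat]
    linarith
  have hSh : ∀ x, 0 < h x → x ∈ S := fun x hx => by
    have h1 : (2⁻¹ : ℝ) < clampReal 2⁻¹ 1 (w x) := by
      simp only [h, NNReal.coe_ofNat] at hx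
      linarith
    have h2 := lt_of_lt_clampReal h1
    refine subset_toMeasurable _ _ ?_
    simp only [mem_ofPred_eq]
    generalize w x = z at h2
    induction z with
    | bot => simp at h2
    | top => simp
    | coe r =>
      have h3 : (2⁻¹ : ℝ) < r := by exact_mod_cast h2
      rw [EReal.abs_def, show (2⁻¹ : ℝ≥0∞) = ENNReal.ofReal 2⁻¹ by
        rw [ENNReal.ofReal_inv_of_pos two_pos, ENNReal.ofReal_ofNat]]
      exact ENNReal.ofReal_le_ofReal (h3.le.trans (le_abs_self r))
  have hwug := (hg.clampReal 2⁻¹ 1 (-1) 2).min_lipschitz hh0 hη η0 hSm hSh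
  refine ⟨fun x => min (h x) (η x), _, ?_, hwug, fun x => le_min (hh0 x) (η0 x), fun x => ?_,
    fun x => min_le_right _ _, fun x hx => ?_, ?_⟩
  · exact ((((measurable_clampReal _ _).comp_aemeasurable wm).const_mul _).add_const _).min
      hη.continuous.measurable.aemeasurable
  · refine (min_le_left _ _).trans ?_
    have := clampReal_le hhalf (w x)
    simp only [h, NNReal.coe_ofNat]
    linarith
  · have : h x = 1 := by
      simp only [h, NNReal.coe_ofNat]
      rw [clampReal_eq_of_le hhalf (by simp [w1 x hx])]
      norm_num
    exact (congrArg (min · (η x)) this).ge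
  · have hmeas : μ S ≤ 2 ^ p * δ := by
      rw [hS, measure_toMeasurable]
      have h1 := mul_meas_ge_le_lintegral₀ (μ := μ)
        ((EReal.measurable_abs.comp_aemeasurable wm).pow_const p) ((2⁻¹ : ℝ≥0∞) ^ p)
      have h2 : {x | (2⁻¹ : ℝ≥0∞) ≤ (w x).abs} ⊆
          {x | (2⁻¹ : ℝ≥0∞) ^ p ≤ (w x).abs ^ p} :=
        fun x hx => ENNReal.rpow_le_rpow hx hp0
      calc μ {x | (2⁻¹ : ℝ≥0∞) ≤ (w x).abs}
          ≤ μ {x | (2⁻¹ : ℝ≥0∞) ^ p ≤ (w x).abs ^ p} := measure_mono h2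
        _ = 2 ^ p * ((2⁻¹ : ℝ≥0∞) ^ p * μ {x | (2⁻¹ : ℝ≥0∞) ^ p ≤ (w x).abs ^ p}) := by
          rw [← mul_assoc, ← ENNReal.mul_rpow_of_nonneg _ _ hp0,
            ENNReal.mul_inv_cancel two_ne_zero ENNReal.ofNat_ne_top, ENNReal.one_rpow, one_mul]
        _ ≤ 2 ^ p * δ := by gcongr; exact h1.trans hwp
    calc ∫⁻ x, max (((2 : ℝ≥0) : ℝ≥0∞) * g x) (S.indicator (fun _ => (L : ℝ≥0∞)) x) ^ p ∂μ
        ≤ ∫⁻ x, (2 ^ p * g x ^ p + S.indicator (fun _ => (L : ℝ≥0∞) ^ p) x) ∂μ := by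
          refine lintegral_mono fun x => ?_
          rw [(ENNReal.monotone_rpow_of_nonneg hp0).map_max]
          refine max_le ?_ ?_
          · rw [ENNReal.mul_rpow_of_nonneg _ _ hp0]
            exact le_self_add
          · refine le_trans (le_of_eq ?_) le_add_self
            by_cases hx : x ∈ S
            · simp [hx]
            · simp [hx, zero_lt_one.trans_le hp]
      _ = 2 ^ p * ∫⁻ x, g x ^ p ∂μ + (L : ℝ≥0∞) ^ p * μ S := by
          rw [lintegral_add_left ((hg.1.pow_const p).const_mul _),
            lintegral_const_mul _ (hg.1.pow_const p), lintegral_indicator_const hSm]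
      _ ≤ 2 ^ p * δ + (L : ℝ≥0∞) ^ p * (2 ^ p * δ) := by gcongr
      _ = 2 ^ p * (1 + (L : ℝ≥0∞) ^ p) * δ := by ring

/-- Lipschitz functions vanishing off `E` which exhaust the interior of `E`. -/
lemma exists_lipschitz_exhaustion (E : Set X) :
    ∃ η : ℕ → X → ℝ, (∀ j : ℕ, LipschitzWith j (η j)) ∧ (∀ j x, 0 ≤ η j x) ∧
      (∀ j, ∀ x ∉ E, η j x = 0) ∧ ∀ x ∈ interior E, ∃ j, ∀ᶠ y in 𝓝 x, 1 ≤ η j y := by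
  rcases (Eᶜ).eq_empty_or_nonempty with hE | hE
  · rw [compl_empty_iff] at hE
    subst hE
    exact ⟨fun _ _ => 1, fun j => LipschitzWith.const' 1 |>.weaken zero_le,
      fun _ _ => zero_le_one, by simp, fun x _ => ⟨0, by simp⟩⟩
  · refine ⟨fun j x => j * infDist x Eᶜ, fun j => ?_, fun j x => mul_nonneg j.cast_nonneg infDist_nonneg,
      fun j x hx => by simp [infDist_zero_of_mem (mem_compl hx)], fun x hx => ?_⟩
    · refine LipschitzWith.of_dist_le_mul fun x y => ?_
      have := (lipschitz_infDist_pt Eᶜ).dist_le_mul x y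
      simp only [← smul_eq_mul, dist_smul₀]
      simpa using mul_le_mul_of_nonneg_left this j.cast_nonneg
    · have hpos : 0 < infDist x Eᶜ := by
        rw [← infDist_pos_iff_notMem_closure hE, closure_compl]
        simpa using hx
      obtain ⟨j, hj⟩ := exists_nat_gt (infDist x Eᶜ)⁻¹
      refine ⟨j, ?_⟩
      have hcont : Continuous fun y => (j : ℝ) * infDist y Eᶜ :=
        continuous_const.mul (continuous_infDist_pt _)
      have h1 : 1 < j * infDist x Eᶜ := by
        rwa [inv_eq_one_div, div_lt_iff₀ hpos] at hj
      exact (hcont.continuousAt.eventually_const_lt h1).mono fun y hy => hy.le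

/-- Perturbing an admissible function for `cap_p(A, E)` to one that is at least `1` on a
neighbourhood of `A`. -/
lemma exists_admissible_near (hp : 1 ≤ p)
    (hball : ∀ (x : X) (r : ℝ), 0 < r → μ (Metric.ball x r) < ⊤)
    {E A : Set X} (hE : Bornology.IsBounded E) (hA : A ⊆ interior E) {u : X → EReal}
    (hqc : QuasicontinuousFun p μ u) (hu : MemNewtonian0 p μ E u) (hu1 : ∀ x ∈ A, 1 ≤ u x)
    {g : X → ℝ≥0∞} (hg : IsWeakUpperGradient p μ u g) (hgt : ∫⁻ x, g x ^ p ∂μ < ⊤) {c : ℝ≥0}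
    (hc : 1 < c) {ε : ℝ≥0∞} (hε : 0 < ε) (hεt : ε < ⊤) :
    ∃ v : X → EReal, (MemNewtonian0 p μ E v ∧
        ∃ G : Set X, IsOpen G ∧ A ⊆ G ∧ ∀ x ∈ G, 1 ≤ v x) ∧
      gradEnergy p μ v ≤ (c : ℝ≥0∞) ^ p * ∫⁻ x, g x ^ p ∂μ + ε := by
  have hp0 : 0 ≤ p := zero_le_one.trans hp
  obtain ⟨η, hηL, η0, ηE, η1⟩ := exists_lipschitz_exhaustion E
  have hK : ∀ j : ℕ, (2 : ℝ≥0∞) ^ p * (1 + ((j : ℝ≥0) : ℝ≥0∞) ^ p) ≠ ⊤ := fun j => by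
    refine ENNReal.mul_ne_top (ENNReal.rpow_ne_top_of_nonneg hp0 ENNReal.ofNat_ne_top) ?_
    exact ENNReal.add_ne_top.2
      ⟨ENNReal.one_ne_top, ENNReal.rpow_ne_top_of_nonneg hp0 ENNReal.coe_ne_top⟩
  obtain ⟨δ, hδ, hsum⟩ := ENNReal.exists_pos_tsum_mul_lt_of_countable hε.ne' _ hK
  choose V hVo hVc _ hVu using fun j => hqc (δ j) (ENNReal.coe_pos.2 (hδ j))
  choose f G fm hG f0 f1 fη fV hGI using fun j =>
    exists_cutoff_of_sobolevCapacity_lt hp (hVc j) (hηL j) (η0 j)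
  have hc0 : (0 : ℝ) < c := zero_lt_one.trans (by exact_mod_cast hc)
  have hcinv : (0 : ℝ) ≤ (c : ℝ)⁻¹ := by positivity
  let F : ℕ → X → ℝ := fun n =>
    n.casesOn (motive := fun _ => X → ℝ) (fun x => c * clampReal 0 (c : ℝ)⁻¹ (u x) + 0) f
  let H : ℕ → X → ℝ≥0∞ := fun n =>
    n.casesOn (motive := fun _ => X → ℝ≥0∞) (fun x => c * g x) G
  have F0 : ∀ o x, 0 ≤ F o x := by
    rintro (_ | j) x
    · simpa [F] using mul_nonneg hc0.le (le_clampReal 0 (c : ℝ)⁻¹ (u x))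
    · exact f0 j x
  have F1 : ∀ o x, F o x ≤ 1 := by
    rintro (_ | j) x
    · have := mul_le_mul_of_nonneg_left (clampReal_le hcinv (u x)) hc0.le
      rw [mul_inv_cancel₀ hc0.ne'] at this
      simpa [F] using this
    · exact f1 j x
  have FE : ∀ o, ∀ x ∉ E, F o x = 0 := by
    rintro (_ | j) x hx
    · have : clampReal 0 (c : ℝ)⁻¹ ((0 : ℝ) : EReal) = 0 := by
        rw [clampReal_coe, min_eq_left hcinv, max_self]
      rw [EReal.coe_zero] at this
      simp [F, hu.2 x hx, this]
    · exact le_antisymm ((fη j x).trans (ηE j x hx).le) (f0 j x)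
  have Fm : ∀ o, AEMeasurable (F o) μ := by
    rintro (_ | j)
    · exact (((measurable_clampReal _ _).comp_aemeasurable hu.1.1).const_mul _).add_const _
    · exact fm j
  have FH : ∀ o : ℕ, IsWeakUpperGradient p μ (fun x => Real.toEReal (F o x)) (H o) := by
    rintro (_ | j)
    · exact hg.clampReal 0 (c : ℝ)⁻¹ 0 c
    · exact hG j
  have Fb : ∀ x, BddAbove (range fun o => F o x) := fun x =>
    ⟨1, by rintro _ ⟨o, rfl⟩; exact F1 o x⟩
  have hvH := IsWeakUpperGradient.iSup hp Fb FH
  set v : X → ℝ := fun x => ⨆ o, F o x with hv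
  have hv0 : ∀ x, 0 ≤ v x := fun x => Real.iSup_nonneg fun o => F0 o x
  have hv1 : ∀ x, v x ≤ 1 := fun x => ciSup_le fun o => F1 o x
  have hvE : ∀ x ∉ E, v x = 0 := fun x hx => by simp [hv, FE _ x hx]
  have hF_le : ∀ o x, F o x ≤ v x := fun o x => le_ciSup (Fb x) o
  have hen : gradEnergy p μ (fun x => (v x : EReal)) ≤
      (c : ℝ≥0∞) ^ p * ∫⁻ x, g x ^ p ∂μ + ε := by
    refine (iInf₂_le _ hvH).trans ((lintegral_iSup_rpow_le hp fun o => (FH o).1).trans ?_)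
    rw [tsum_eq_zero_add' ENNReal.summable]
    refine add_le_add (le_of_eq ?_) ((ENNReal.tsum_le_tsum fun j => hGI j).trans hsum.le)
    change ∫⁻ x, (c * g x) ^ p ∂μ = _
    simp only [ENNReal.mul_rpow_of_nonneg _ _ hp0]
    exact lintegral_const_mul _ (hg.1.pow_const p)
  have hen_top : gradEnergy p μ (fun x => (v x : EReal)) < ⊤ :=
    hen.trans_lt (ENNReal.add_lt_top.2 ⟨ENNReal.mul_lt_top
      (ENNReal.rpow_lt_top_of_nonneg hp0 ENNReal.coe_ne_top) hgt, hεt⟩)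
  have hvp : ∫⁻ x, (v x : EReal).abs ^ p ∂μ < ⊤ := by
    rcases isEmpty_or_nonempty X with hX | ⟨⟨x₀⟩⟩
    · simp [Measure.eq_zero_of_isEmpty μ]
    obtain ⟨r, hr⟩ := hE.subset_ball x₀
    have hr' : E ⊆ ball x₀ (max r 1) := hr.trans (ball_subset_ball (le_max_left _ _))
    calc ∫⁻ x, (v x : EReal).abs ^ p ∂μ
        ≤ ∫⁻ x, (ball x₀ (max r 1)).indicator (fun _ => 1) x ∂μ := by
          refine lintegral_mono fun x => ?_
          by_cases hx : x ∈ ball x₀ (max r 1)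
          · rw [indicator_of_mem hx, EReal.abs_def, abs_of_nonneg (hv0 x)]
            exact ENNReal.rpow_le_one (ENNReal.ofReal_le_one.2 (hv1 x)) hp0
          · simp [hvE x fun h => hx (hr' h), zero_lt_one.trans_le hp]
      _ = μ (ball x₀ (max r 1)) := by
          rw [lintegral_indicator_const measurableSet_ball, one_mul]
      _ < ⊤ := hball _ _ (by positivity)
  refine ⟨fun x => (v x : EReal), ⟨⟨⟨?_, ENNReal.add_lt_top.2 ⟨hvp, hen_top⟩⟩,
    fun x hx => by simp [hvE x hx]⟩, interior {y : X | 1 ≤ v y}, isOpen_interior, fun x hx => ?_,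
    fun x hx => ?_⟩, hen⟩
  · exact (AEMeasurable.iSup Fm).coe_real_ereal
  · rw [mem_interior_iff_mem_nhds]
    change ∀ᶠ y in 𝓝 x, 1 ≤ v y
    obtain ⟨j, hj⟩ := η1 x (hA hx)
    have hVv : ∀ᶠ y in 𝓝 x, y ∈ V j → 1 ≤ v y := hj.mono fun y hy hyV =>
      ((le_min le_rfl hy).trans (fV j y hyV)).trans (hF_le (j + 1) y)
    by_cases hxV : x ∈ V j
    · filter_upwards [hVv, (hVo j).mem_nhds hxV] with y h1 h2 using h1 h2
    · have hlt : (((c : ℝ)⁻¹ : ℝ) : EReal) < u x := by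
        refine lt_of_lt_of_le ?_ (hu1 x hx)
        exact_mod_cast inv_lt_one_of_one_lt₀ (by exact_mod_cast hc : (1 : ℝ) < c)
      have h1 := (hVu j x hxV).eventually_const_lt hlt
      rw [eventually_nhdsWithin_iff] at h1
      filter_upwards [hVv, h1] with y h2 h3
      by_cases hyV : y ∈ V j
      · exact h2 hyV
      · refine le_trans (le_of_eq ?_) (hF_le 0 y)
        simp [F, clampReal_eq_of_le hcinv (h3 hyV).le, mul_inv_cancel₀ hc0.ne']
  · have : x ∈ {y : X | 1 ≤ v y} := interior_subset hx
    exact EReal.coe_le_coe_iff.2 this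

end Capacity

/-- Characterization of `cap_p(A,E)` via functions that are `≥ 1` on an
open neighbourhood of `A`. -/
theorem stmt_13 (p : ℝ) (hp : 1 ≤ p) (μ : Measure X)
    (hball : ∀ (x : X) (r : ℝ), 0 < r → 0 < μ (Metric.ball x r) ∧ μ (Metric.ball x r) < ⊤)
    (hqc : ∀ u : X → EReal, MemNewtonian p μ u → QuasicontinuousFun p μ u)
    (E : Set X) (hE : Bornology.IsBounded E)
    (A : Set X) (hAE : A ⊆ E)
    (hA : (1 < p ∧ A ⊆ interior E) ∨
      (p = 1 ∧ ∃ d : ℝ, 0 < d ∧ ∀ x ∈ A, ∀ y ∉ E, d ≤ dist x y)) :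
    varCapacity p μ A E =
      ⨅ (u : X → EReal) (_ : MemNewtonian0 p μ E u ∧
        ∃ G : Set X, IsOpen G ∧ A ⊆ G ∧ ∀ x ∈ G, 1 ≤ u x), gradEnergy p μ u := by
  have hAint : A ⊆ interior E := by
    rcases hA with ⟨-, h⟩ | ⟨-, d, hd, h⟩
    · exact h
    · intro x hx
      rw [mem_interior_iff_mem_nhds]
      refine mem_of_superset (ball_mem_nhds x hd) fun y hy => ?_
      by_contra hyE
      exact absurd (h x hx y hyE) (not_le.2 (mem_ball'.1 hy))
  refine le_antisymm ?_ ?_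
  · refine le_iInf₂ fun u hu => iInf₂_le u ⟨hu.1, ?_⟩
    obtain ⟨G, -, hAG, hG⟩ := hu.2
    exact fun x hx => hG x (hAG hx)
  · refine le_iInf₂ fun u hu => le_iInf₂ fun g hg => ?_
    rcases eq_or_ne (∫⁻ x, g x ^ p ∂μ) ⊤ with hgt | hgt
    · rw [hgt]
      exact le_top
    have hp0 : 0 ≤ p := zero_le_one.trans hp
    have key : ∀ c : ℝ≥0, 1 < c → (⨅ (u : X → EReal) (_ : MemNewtonian0 p μ E u ∧
        ∃ G : Set X, IsOpen G ∧ A ⊆ G ∧ ∀ x ∈ G, 1 ≤ u x), gradEnergy p μ u) ≤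
        (c : ℝ≥0∞) ^ p * ∫⁻ x, g x ^ p ∂μ := by
      intro c hc
      refine ENNReal.le_of_forall_pos_le_add fun ε hε _ => ?_
      obtain ⟨v, hv, hvε⟩ := exists_admissible_near hp (fun x r hr => (hball x r hr).2) hE hAint
        (hqc u hu.1.1) hu.1 hu.2 hg hgt.lt_top hc (ENNReal.coe_pos.2 hε) ENNReal.coe_lt_top
      exact (iInf₂_le v hv).trans hvε
    have hlim : Tendsto (fun c : ℝ≥0 => (c : ℝ≥0∞) ^ p * ∫⁻ x, g x ^ p ∂μ) (𝓝[>] 1)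
        (𝓝 (((1 : ℝ≥0) : ℝ≥0∞) ^ p * ∫⁻ x, g x ^ p ∂μ)) := by
      refine ENNReal.Tendsto.mul_const ?_ (Or.inr hgt)
      exact ((ENNReal.continuous_rpow_const.comp ENNReal.continuous_coe).tendsto 1).mono_left
        nhdsWithin_le_nhds
    rw [ENNReal.coe_one, ENNReal.one_rpow, one_mul] at hlim
    exact ge_of_tendsto hlim (eventually_mem_nhdsWithin.mono key)

end
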